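/- arXiv:0901.3984 — 2 statements merged into one kernel-verified Lean document; each statement's English description precedes it below -/
import Mathlib

section
/- The following problem is undecidable: given a finite set Σ of TGDs and EGDs, a constraint α ∈ Σ, and a database instance I, decide whether α is (I,Σ)-irrelevant. -/
set_option maxHeartbeats 1000000

namespace StopChase

/-! ## Basic objects: values, terms, relation symbols, atoms, facts -/

/-- Database values: constants from `Δ` and labeled nulls from `Δ_null`. -/
inductive Val : Type
  | const : ℕ → Val
  | null : ℕ → Val
  deriving DecidableEq

/-- `v` is a labeled null. -/
def Val.isNull : Val → Prop
  | .null _ => True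
  | .const _ => False

/-- Terms: variables or constant parameters. -/
inductive Term : Type
  | var : ℕ → Term
  | const : ℕ → Term
  deriving DecidableEq

/-- Relation symbols of a universal schema: a name together with an arity. -/
abbrev RelSym : Type := ℕ × ℕ

/-- The arity of a relation symbol. -/
def RelSym.arity (R : RelSym) : ℕ := R.2

/-- A position `R^i` of a relation symbol. -/
abbrev Pos : Type := RelSym × ℕ

/-- An atom: a relation symbol applied to a list of terms. -/
structure Atom : Type where
  rel : RelSym
  args : List Term
  deriving DecidableEq

/-- Well-formedness of an atom: the number of arguments matches the arity. -/
def Atom.wf (A : Atom) : Prop := A.args.length = A.rel.arity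

/-- A fact: a relation symbol applied to a list of values. -/
structure Fact : Type where
  rel : RelSym
  args : List Val
  deriving DecidableEq

/-- Well-formedness of a fact. -/
def Fact.wf (F : Fact) : Prop := F.args.length = F.rel.arity

/-- The variables occurring in an atom. -/
def Atom.vars (A : Atom) : Set ℕ := {v | Term.var v ∈ A.args}

/-- The variables occurring in a list of atoms. -/
def varsOf (L : List Atom) : Set ℕ := {v | ∃ A ∈ L, v ∈ A.vars}

/-- Variable `v` occurs at position `π` in the list of atoms `L`. -/
def occursAt (L : List Atom) (v : ℕ) (π : Pos) : Prop :=
  ∃ A ∈ L, A.rel = π.1 ∧ A.args[π.2]? = some (Term.var v)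

/-- The set of positions of a list of atoms. -/
def posOfAtoms (L : List Atom) : Set Pos :=
  {π | ∃ A ∈ L, A.rel = π.1 ∧ π.2 < A.args.length}

/-! ## Constraints: TGDs and EGDs -/

/-- A tuple generating dependency `∀ x̄ (φ(x̄) → ∃ ȳ ψ(x̄,ȳ))`, given by its body `φ`
and head `ψ`.  The universally quantified variables are those occurring in the body;
head variables not occurring in the body are (implicitly) existentially quantified. -/
structure TGD : Type where
  body : List Atom
  head : List Atom
  deriving DecidableEq

/-- Well-formedness of a TGD: the head is nonempty and all atoms are well-formed. -/
def TGD.wf (t : TGD) : Prop :=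
  t.head ≠ [] ∧ (∀ A ∈ t.body, A.wf) ∧ (∀ A ∈ t.head, A.wf)

/-- The universally quantified variables of a TGD. -/
def TGD.uniVars (t : TGD) : Set ℕ := varsOf t.body

/-- The existentially quantified variables of a TGD. -/
def TGD.exVars (t : TGD) : Set ℕ := varsOf t.head \ varsOf t.body

/-- An equality generating dependency `∀ x̄ (φ(x̄) → x_i = x_j)`. -/
structure EGD : Type where
  body : List Atom
  lhs : ℕ
  rhs : ℕ
  deriving DecidableEq

/-- Well-formedness of an EGD: nonempty well-formed body and both equated
variables occur in the body. -/
def EGD.wf (e : EGD) : Prop :=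
  e.body ≠ [] ∧ (∀ A ∈ e.body, A.wf) ∧ e.lhs ∈ varsOf e.body ∧ e.rhs ∈ varsOf e.body

/-- A constraint is a TGD or an EGD. -/
inductive Constraint : Type
  | tgd : TGD → Constraint
  | egd : EGD → Constraint
  deriving DecidableEq

/-- Well-formedness of a constraint. -/
def Constraint.wf : Constraint → Prop
  | .tgd t => t.wf
  | .egd e => e.wf

/-- The body atoms of a constraint. -/
def Constraint.bodyAtoms : Constraint → List Atom
  | .tgd t => t.body
  | .egd e => e.body

/-- `pos(α)`: the set of positions occurring in the body of `α`. -/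
def Constraint.pos (α : Constraint) : Set Pos := posOfAtoms α.bodyAtoms

/-- `pos(Σ)`: the set of positions occurring in the bodies of constraints of `Σ`. -/
def posOf (S : Set Constraint) : Set Pos := ⋃ α ∈ S, α.pos

/-- The universally quantified variables occurring in the head of a constraint
(for an EGD, the two equated variables). -/
def Constraint.headUniVars : Constraint → Set ℕ
  | .tgd t => varsOf t.head ∩ varsOf t.body
  | .egd e => {e.lhs, e.rhs}

/-! ## Semantics -/

/-- Evaluation of a term under an assignment `ν : V → Δ ∪ Δ_null`. -/
def Term.eval (ν : ℕ → Val) : Term → Val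
  | .var v => ν v
  | .const c => Val.const c

/-- Instantiation of an atom to a fact. -/
def Atom.inst (ν : ℕ → Val) (A : Atom) : Fact := ⟨A.rel, A.args.map (Term.eval ν)⟩

/-- All atoms of `L`, instantiated by `ν`, hold in the instance `I`. -/
def bodyHolds (I : Set Fact) (L : List Atom) (ν : ℕ → Val) : Prop :=
  ∀ A ∈ L, A.inst ν ∈ I

/-- `I ⊨ α(ā)`: the constraint `α` holds in `I` under the assignment `ν` of its
universally quantified variables. -/
def Constraint.satAt : Constraint → Set Fact → (ℕ → Val) → Prop
  | .tgd t, I, ν => bodyHolds I t.body ν →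
      ∃ ν' : ℕ → Val, (∀ v ∈ varsOf t.body, ν' v = ν v) ∧ bodyHolds I t.head ν'
  | .egd e, I, ν => bodyHolds I e.body ν → ν e.lhs = ν e.rhs

/-- `I ⊨ α`. -/
def Constraint.holds (α : Constraint) (I : Set Fact) : Prop := ∀ ν, α.satAt I ν

/-- The active domain of an instance: the set of values occurring in it. -/
def adom (I : Set Fact) : Set Val := {v | ∃ F ∈ I, v ∈ F.args}

/-- Substitution of the value `a` by the value `b`. -/
def Val.subst (a b : Val) (v : Val) : Val := if v = a then b else v

/-- Substitution applied to a fact. -/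
def Fact.substF (a b : Val) (F : Fact) : Fact := ⟨F.rel, F.args.map (Val.subst a b)⟩

/-! ## Chase steps and chase sequences -/

/-- A chase step `I →_{α,ā} J`: the instance `I` violates `α(ā)` and `J` is
obtained from `I` by adding the head atoms instantiated with fresh labeled nulls
for the existentially quantified variables (TGDs), resp. by equating a labeled
null with another value (EGDs). -/
def Constraint.chaseStep (α : Constraint) (ν : ℕ → Val) (I J : Set Fact) : Prop :=
  ¬ α.satAt I ν ∧
  match α with
  | .tgd t =>
      ∃ ν' : ℕ → Val,
        (∀ v ∈ varsOf t.body, ν' v = ν v) ∧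
        (∀ v ∈ t.exVars, (ν' v).isNull ∧ ν' v ∉ adom I) ∧
        (∀ v ∈ t.exVars, ∀ w ∈ t.exVars, ν' v = ν' w → v = w) ∧
        J = I ∪ {F | ∃ A ∈ t.head, F = A.inst ν'}
  | .egd e =>
      ∃ a b : Val, a.isNull ∧ ({a, b} : Set Val) = {ν e.lhs, ν e.rhs} ∧
        J = Fact.substF a b '' I

/-- The data of a (finite or infinite) chase sequence: the instances, and
the constraint and assignment used at each step. -/
structure ChaseData : Type where
  inst : ℕ → Set Fact
  cns : ℕ → Constraint
  asg : ℕ → ℕ → Val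

/-- `D` is a chase sequence of length (at least) `r` with constraints from `S`. -/
def ChaseData.okUpTo (D : ChaseData) (S : Set Constraint) (r : ℕ) : Prop :=
  ∀ i < r, D.cns i ∈ S ∧ (D.cns i).chaseStep (D.asg i) (D.inst i) (D.inst (i+1))

/-- `D` is an infinite chase sequence with constraints from `S`. -/
def ChaseData.okAll (D : ChaseData) (S : Set Constraint) : Prop :=
  ∀ i, D.cns i ∈ S ∧ (D.cns i).chaseStep (D.asg i) (D.inst i) (D.inst (i+1))

/-- The nulls freshly introduced in the first `r` steps are globally fresh,
i.e. do not occur in any earlier instance of the sequence. -/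
def ChaseData.fresh (D : ChaseData) (r : ℕ) : Prop :=
  ∀ i < r, ∀ v, v.isNull → v ∈ adom (D.inst (i+1)) → v ∉ adom (D.inst i) →
    ∀ j ≤ i, v ∉ adom (D.inst j)

/-- Global freshness for an infinite sequence. -/
def ChaseData.freshAll (D : ChaseData) : Prop := ∀ r, D.fresh r

/-- The chase with `S` terminates on the instance `I`: there is no infinite
chase sequence starting from `I`. -/
def chaseTerminates (S : Set Constraint) (I : Set Fact) : Prop :=
  ¬ ∃ D : ChaseData, D.inst 0 = I ∧ D.okAll S

/-- `J` is a result of the chase of `I` with `S`: it is the final instance of a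
finite chase sequence starting from `I` and satisfies all constraints of `S`. -/
def ChaseResult (S : Set Constraint) (I J : Set Fact) : Prop :=
  ∃ (D : ChaseData) (r : ℕ), D.inst 0 = I ∧ D.okUpTo S r ∧ D.inst r = J ∧
    ∀ α ∈ S, α.holds J

/-- `α` is `(I,S)`-irrelevant: no chase sequence starting from `I` with `S`
contains a chase step applying `α`. -/
def Irrelevant (I : Set Fact) (S : Set Constraint) (α : Constraint) : Prop :=
  ¬ ∃ (D : ChaseData) (r : ℕ), D.inst 0 = I ∧ D.okUpTo S r ∧ ∃ i < r, D.cns i = α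

/-! ## Affected positions, propagation graph and safety -/

/-- The affected positions `aff(S)` of (the TGDs of) a constraint set `S`. -/
inductive Affected (S : Set Constraint) : Pos → Prop
  | ex (t : TGD) (y : ℕ) (π : Pos) :
      Constraint.tgd t ∈ S → y ∈ t.exVars → occursAt t.head y π → Affected S π
  | uni (t : TGD) (x : ℕ) (π : Pos) :
      Constraint.tgd t ∈ S → x ∈ t.uniVars → occursAt t.head x π →
      (∃ π', occursAt t.body x π') →
      (∀ π', occursAt t.body x π' → Affected S π') → Affected S π

/-- A (non-special) edge `π1 → π2` of the propagation graph `prop(S)`. -/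
def propEdge (S : Set Constraint) (π1 π2 : Pos) : Prop :=
  ∃ t, Constraint.tgd t ∈ S ∧ ∃ x ∈ t.uniVars, x ∈ varsOf t.head ∧
    occursAt t.body x π1 ∧ (∀ π, occursAt t.body x π → Affected S π) ∧
    occursAt t.head x π2

/-- A special edge `π1 →* π2` of the propagation graph `prop(S)`. -/
def propSpecialEdge (S : Set Constraint) (π1 π2 : Pos) : Prop :=
  ∃ t, Constraint.tgd t ∈ S ∧ ∃ x ∈ t.uniVars, x ∈ varsOf t.head ∧
    occursAt t.body x π1 ∧ (∀ π, occursAt t.body x π → Affected S π) ∧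
    ∃ y ∈ t.exVars, occursAt t.head y π2

/-- Any edge of the propagation graph. -/
def propAnyEdge (S : Set Constraint) (π1 π2 : Pos) : Prop :=
  propEdge S π1 π2 ∨ propSpecialEdge S π1 π2

/-- `S` is safe: the propagation graph `prop(S)` has no cycle going through a
special edge. -/
def IsSafe (S : Set Constraint) : Prop :=
  ¬ ∃ π1 π2, propSpecialEdge S π1 π2 ∧ Relation.ReflTransGen (propAnyEdge S) π2 π1

/-! ## Restriction systems -/

/-- The fact `F` has a labeled null at position `π`. -/
def Fact.nullAt (F : Fact) (π : Pos) : Prop :=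
  F.rel = π.1 ∧ ∃ v, F.args[π.2]? = some v ∧ v.isNull

/-- The instance `I` contains labeled nulls only in positions from `P`. -/
def nullsOnlyIn (I : Set Fact) (P : Set Pos) : Prop :=
  ∀ F ∈ I, ∀ π : Pos, F.nullAt π → π ∈ P

/-- `α ≺_P β`. -/
def prec (P : Set Pos) (α β : Constraint) : Prop :=
  ∃ (I J : Set Fact) (a b : ℕ → Val),
    I.Finite ∧ nullsOnlyIn I P ∧
    ¬ α.satAt I a ∧ β.satAt I b ∧
    α.chaseStep a I J ∧ ¬ β.satAt J b ∧
    ∃ v ∈ β.headUniVars, (b v).isNull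

/-- `aff-cl(t,P)` for a TGD `t` and a set of positions `P`. -/
def affCl (t : TGD) (P : Set Pos) : Set Pos :=
  {π | π ∈ posOfAtoms t.head ∧
    ((∀ x ∈ t.uniVars, occursAt t.head x π → ∀ π', occursAt t.body x π' → π' ∈ P) ∨
     (∃ y ∈ t.exVars, occursAt t.head y π))}

/-- A restriction system: a directed graph on constraints together with a
position-set labelling. -/
structure RestrSys : Type where
  E : Constraint → Constraint → Prop
  f : Constraint → Set Pos

/-- The defining closure conditions of a restriction system for `S`. -/
def RestrSys.valid (S : Set Constraint) (R : RestrSys) : Prop :=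
  (∀ t : TGD, ∀ β, Constraint.tgd t ∈ S → β ∈ S → R.E (.tgd t) β →
      affCl t (R.f (.tgd t)) ∩ β.pos ⊆ R.f β) ∧
  (∀ e : EGD, ∀ β, Constraint.egd e ∈ S → β ∈ S → R.E (.egd e) β →
      R.f (.egd e) ∩ β.pos ⊆ R.f β) ∧
  (∀ α β, α ∈ S → β ∈ S → prec (R.f α) α β → R.E α β)

/-- Pointwise inclusion of restriction systems. -/
def RestrSys.le (R1 R2 : RestrSys) : Prop :=
  (∀ a b, R1.E a b → R2.E a b) ∧ (∀ a, R1.f a ⊆ R2.f a)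

/-- The minimal restriction system of `S` (obtained from the empty system by
repeatedly enforcing the closure conditions, extending only as required). -/
def IsMinimalRS (S : Set Constraint) (R : RestrSys) : Prop :=
  R.valid S ∧ ∀ R', R'.valid S → R.le R'

/-- The edge relation of a restriction system, restricted to `S`. -/
def edgeOn (S : Set Constraint) (E : Constraint → Constraint → Prop)
    (a b : Constraint) : Prop :=
  a ∈ S ∧ b ∈ S ∧ E a b

/-- The strongly connected component of `α`. -/
def sccOf (S : Set Constraint) (E : Constraint → Constraint → Prop)
    (α : Constraint) : Set Constraint :=
  {β | β ∈ S ∧ Relation.ReflTransGen (edgeOn S E) α β ∧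
    Relation.ReflTransGen (edgeOn S E) β α}

/-- The (nontrivial) strongly connected components of the graph `(S,E)`,
i.e. those containing a cycle. -/
def SCCs (S : Set Constraint) (E : Constraint → Constraint → Prop) :
    Set (Set Constraint) :=
  {C | ∃ α ∈ S, Relation.TransGen (edgeOn S E) α α ∧ C = sccOf S E α}

/-- `PartMem S S'` holds iff `S' ∈ part(S)`, where `part` is the recursive
algorithm computing strongly connected components of minimal restriction
systems. -/
inductive PartMem : Set Constraint → Set Constraint → Prop
  | base (S : Set Constraint) (R : RestrSys) :
      IsMinimalRS S R → SCCs S R.E = {S} → PartMem S S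
  | step (S : Set Constraint) (R : RestrSys) (C S' : Set Constraint) :
      IsMinimalRS S R → SCCs S R.E ≠ {S} → C ∈ SCCs S R.E →
      PartMem C S' → PartMem S S'

/-- `S` is inductively restricted: every `S' ∈ part(S)` is safe. -/
def InductivelyRestricted (S : Set Constraint) : Prop :=
  ∀ S', PartMem S S' → IsSafe S'

/-- `S` is safely restricted: every strongly connected component of its
minimal restriction system is safe. -/
def SafelyRestricted (S : Set Constraint) : Prop :=
  ∀ R, IsMinimalRS S R → ∀ C ∈ SCCs S R.E, IsSafe C

/-! ## Monitor graphs -/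

/-- A node of a monitor graph: a value together with a set of positions. -/
abbrev MNode : Type := Val × Set Pos

/-- A labeled edge of a monitor graph. -/
structure MEdge : Type where
  src : MNode
  cns : Constraint
  lbl : Set Pos
  tgt : MNode

/-- The labeled nulls newly introduced by a chase step from `I` to `J`. -/
def newNulls (I J : Set Fact) : Set Val := {v | v.isNull ∧ v ∈ adom J ∧ v ∉ adom I}

/-- The set of positions at which the value `v` occurs in the instance `I`. -/
def posOfVal (I : Set Fact) (v : Val) : Set Pos :=
  {π | ∃ F ∈ I, F.rel = π.1 ∧ F.args[π.2]? = some v}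

/-- The set of positions of the instantiated body `body(α(ā))` in which the
value `v` occurs. -/
def instBodyPos (α : Constraint) (ν : ℕ → Val) (v : Val) : Set Pos :=
  {π | ∃ A ∈ α.bodyAtoms, A.rel = π.1 ∧ (A.args.map (Term.eval ν))[π.2]? = some v}

/-- The monitor-graph nodes created by the `i`-th chase step. -/
def ChaseData.mgNew (D : ChaseData) (i : ℕ) : Set MNode :=
  {p | ∃ n ∈ newNulls (D.inst i) (D.inst (i+1)), p = (n, posOfVal (D.inst (i+1)) n)}

/-- The nodes of the monitor graph of the length-`i` prefix of `D`. -/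
def ChaseData.mgV (D : ChaseData) : ℕ → Set MNode
  | 0 => ∅
  | i+1 => D.mgV i ∪ D.mgNew i

/-- The edges of the monitor graph of the length-`i` prefix of `D`. -/
def ChaseData.mgE (D : ChaseData) : ℕ → Set MEdge
  | 0 => ∅
  | i+1 => D.mgE i ∪
      {e | e.src ∈ D.mgV i ∧ e.tgt ∈ D.mgNew i ∧ e.cns = D.cns i ∧
           e.lbl = instBodyPos (D.cns i) (D.asg i) e.src.1}

/-- A path in a monitor graph: a list of edges of the graph in which consecutive
edges are chained (`p_{5,6}(e_i) = p_{1,2}(e_{i+1})`). -/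
def IsPath (E : Set MEdge) (l : List MEdge) : Prop :=
  (∀ e ∈ l, e ∈ E) ∧ l.Chain' (fun a b => a.tgt = b.src)

/-- The projection `p_{2,3,4,6}` of an edge. -/
def MEdge.sig (e : MEdge) : Set Pos × Constraint × Set Pos × Set Pos :=
  (e.src.2, e.cns, e.lbl, e.tgt.2)

/-- A monitor graph with edge set `E` is `k`-cyclic: some path contains `k`
pairwise distinct edges, in order, that agree on the projection `p_{2,3,4,6}`. -/
def kCyclic (E : Set MEdge) (k : ℕ) : Prop :=
  ∃ l es : List MEdge, IsPath E l ∧ es.Sublist l ∧ es.length = k ∧ es.Nodup ∧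
    es.Chain' (fun a b => a.sig = b.sig)

/-- `DepthLe E v d`: the depth of the node `v` in the monitor graph with edge
set `E` is at most `d` (depth `0` for nodes without predecessors, and `1` plus
the maximal depth of the predecessors otherwise). -/
inductive DepthLe (E : Set MEdge) : MNode → ℕ → Prop
  | intro (v : MNode) (d : ℕ) (f : MEdge → ℕ) :
      (∀ e ∈ E, e.tgt = v → f e < d) →
      (∀ e, e ∈ E → e.tgt = v → DepthLe E e.src (f e)) → DepthLe E v d

/-- The node `v` has depth exactly `d`. -/
def HasDepth (E : Set MEdge) (v : MNode) (d : ℕ) : Prop :=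
  DepthLe E v d ∧ ∀ d' < d, ¬ DepthLe E v d'


/-! ## Encodings of the syntactic objects -/

def Val.equivSum : Val ≃ ℕ ⊕ ℕ where
  toFun := fun v => match v with | .const c => .inl c | .null n => .inr n
  invFun := fun s => match s with | .inl c => .const c | .inr n => .null n
  left_inv := by intro v; cases v <;> rfl
  right_inv := by intro s; cases s <;> rfl

instance : Primcodable Val := Primcodable.ofEquiv _ Val.equivSum

def Term.equivSum : Term ≃ ℕ ⊕ ℕ where
  toFun := fun t => match t with | .var v => .inl v | .const c => .inr c
  invFun := fun s => match s with | .inl v => .var v | .inr c => .const c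
  left_inv := by intro t; cases t <;> rfl
  right_inv := by intro s; cases s <;> rfl

instance : Primcodable Term := Primcodable.ofEquiv _ Term.equivSum

def Atom.equivProd : Atom ≃ (ℕ × ℕ) × List Term where
  toFun A := (A.rel, A.args)
  invFun p := ⟨p.1, p.2⟩
  left_inv := fun _ => rfl
  right_inv := fun _ => rfl

instance : Primcodable Atom := Primcodable.ofEquiv _ Atom.equivProd

def Fact.equivProd : Fact ≃ (ℕ × ℕ) × List Val where
  toFun F := (F.rel, F.args)
  invFun p := ⟨p.1, p.2⟩
  left_inv := fun _ => rfl
  right_inv := fun _ => rfl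

instance : Primcodable Fact := Primcodable.ofEquiv _ Fact.equivProd

def TGD.equivProd : TGD ≃ List Atom × List Atom where
  toFun t := (t.body, t.head)
  invFun p := ⟨p.1, p.2⟩
  left_inv := fun _ => rfl
  right_inv := fun _ => rfl

instance : Primcodable TGD := Primcodable.ofEquiv _ TGD.equivProd

def EGD.equivProd : EGD ≃ List Atom × ℕ × ℕ where
  toFun e := (e.body, e.lhs, e.rhs)
  invFun p := ⟨p.1, p.2.1, p.2.2⟩
  left_inv := fun _ => rfl
  right_inv := fun _ => rfl

instance : Primcodable EGD := Primcodable.ofEquiv _ EGD.equivProd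

def Constraint.equivSum : Constraint ≃ TGD ⊕ EGD where
  toFun := fun c => match c with | .tgd t => .inl t | .egd e => .inr e
  invFun := fun s => match s with | .inl t => .tgd t | .inr e => .egd e
  left_inv := by intro c; cases c <;> rfl
  right_inv := by intro s; cases s <;> rfl

instance : Primcodable Constraint := Primcodable.ofEquiv _ Constraint.equivSum

/-! ## The reduction -/

section Reduction

set_option linter.unusedSimpArgs false

open Turing.ToPartrec

/-- Injective numbering of codes, used to name relation symbols. -/
def enc : Code → ℕ
  | .zero' => 0
  | .succ => 1
  | .tail => 2
  | .cons f g => 4 * Nat.pair (enc f) (enc g) + 3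
  | .comp f g => 4 * Nat.pair (enc f) (enc g) + 4
  | .case f g => 4 * Nat.pair (enc f) (enc g) + 5
  | .fix f => 4 * enc f + 6

theorem enc_inj : ∀ c d : Code, enc c = enc d → c = d := by
  intro c
  induction c with
  | zero' => intro d h; cases d <;> simp [enc] at h ⊢
  | succ => intro d h; cases d <;> simp [enc] at h ⊢
  | tail => intro d h; cases d <;> simp [enc] at h ⊢
  | cons f g hf hg =>
    intro d h
    cases d <;> simp only [enc] at h <;> try omega
    have h' := Nat.pair_eq_pair.1
      (Nat.eq_of_mul_eq_mul_left (by norm_num) (Nat.add_right_cancel h))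
    rw [hf _ h'.1, hg _ h'.2]
  | comp f g hf hg =>
    intro d h
    cases d <;> simp only [enc] at h <;> try omega
    have h' := Nat.pair_eq_pair.1
      (Nat.eq_of_mul_eq_mul_left (by norm_num) (Nat.add_right_cancel h))
    rw [hf _ h'.1, hg _ h'.2]
  | case f g hf hg =>
    intro d h
    cases d <;> simp only [enc] at h <;> try omega
    have h' := Nat.pair_eq_pair.1
      (Nat.eq_of_mul_eq_mul_left (by norm_num) (Nat.add_right_cancel h))
    rw [hf _ h'.1, hg _ h'.2]
  | fix f hf =>
    intro d h
    cases d <;> simp only [enc] at h <;> try omega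
    rw [hf _ (Nat.eq_of_mul_eq_mul_left (by norm_num) (Nat.add_right_cancel h))]

/-- Atoms with variable arguments. -/
def mkA (r : ℕ) (l : List ℕ) : Atom := ⟨(r, l.length), l.map Term.var⟩

/-- Facts of matching arity. -/
def mkF (r : ℕ) (l : List Val) : Fact := ⟨(r, l.length), l⟩

theorem inst_mkA (ν : ℕ → Val) (r : ℕ) (l : List ℕ) :
    (mkA r l).inst ν = mkF r (l.map ν) := by
  simp [mkA, mkF, Atom.inst, Function.comp_def, Term.eval]

/-- Name of the evaluation relation of a code. -/
def eN (c : Code) : ℕ := enc c + 9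

/- Relation names: 0 domain, 1 zero, 2 successor, 3 nil, 4 cons, 5 head, 6 tail, 7 input, 8 goal. -/

def rZ : TGD := ⟨[], [mkA 1 [0], mkA 0 [0]]⟩
def rS : TGD := ⟨[mkA 0 [0]], [mkA 2 [0, 1], mkA 0 [1]]⟩
def rN : TGD := ⟨[], [mkA 3 [0], mkA 0 [0]]⟩
def rC : TGD := ⟨[mkA 0 [0], mkA 0 [1]], [mkA 4 [0, 1, 2], mkA 0 [2]]⟩
def rH0 : TGD := ⟨[mkA 3 [0], mkA 1 [1]], [mkA 5 [0, 1], mkA 6 [0, 0]]⟩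
def rH1 : TGD := ⟨[mkA 4 [0, 1, 2]], [mkA 5 [2, 0], mkA 6 [2, 1]]⟩

/-- Rules shared by all programs. -/
def baseRules : List TGD := [rZ, rS, rN, rC, rH0, rH1]

def rZero : TGD := ⟨[mkA 1 [0], mkA 4 [0, 1, 2]], [mkA (eN .zero') [1, 2]]⟩
def rSucc : TGD :=
  ⟨[mkA 5 [0, 1], mkA 2 [1, 2], mkA 3 [3], mkA 4 [2, 3, 4]], [mkA (eN .succ) [0, 4]]⟩
def rTail : TGD := ⟨[mkA 6 [0, 1]], [mkA (eN .tail) [0, 1]]⟩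
def rCons (f g : Code) : TGD :=
  ⟨[mkA (eN f) [0, 1], mkA 5 [1, 2], mkA (eN g) [0, 3], mkA 4 [2, 3, 4]],
    [mkA (eN (.cons f g)) [0, 4]]⟩
def rComp (f g : Code) : TGD :=
  ⟨[mkA (eN g) [0, 1], mkA (eN f) [1, 2]], [mkA (eN (.comp f g)) [0, 2]]⟩
def rCase0 (f g : Code) : TGD :=
  ⟨[mkA 5 [0, 1], mkA 1 [1], mkA 6 [0, 2], mkA (eN f) [2, 3]], [mkA (eN (.case f g)) [0, 3]]⟩
def rCase1 (f g : Code) : TGD :=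
  ⟨[mkA 5 [0, 1], mkA 2 [2, 1], mkA 6 [0, 3], mkA 4 [2, 3, 4], mkA (eN g) [4, 5]],
    [mkA (eN (.case f g)) [0, 5]]⟩
def rFix0 (f : Code) : TGD :=
  ⟨[mkA (eN f) [0, 1], mkA 5 [1, 2], mkA 1 [2], mkA 6 [1, 3]], [mkA (eN (.fix f)) [0, 3]]⟩
def rFix1 (f : Code) : TGD :=
  ⟨[mkA (eN f) [0, 1], mkA 5 [1, 2], mkA 2 [3, 2], mkA 6 [1, 4], mkA (eN (.fix f)) [4, 5]],
    [mkA (eN (.fix f)) [0, 5]]⟩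

/-- The rules describing the evaluation of a code. -/
def rules : Code → List TGD
  | .zero' => [rZero]
  | .succ => [rSucc]
  | .tail => [rTail]
  | .cons f g => rCons f g :: (rules f ++ rules g)
  | .comp f g => rComp f g :: (rules f ++ rules g)
  | .case f g => rCase0 f g :: rCase1 f g :: (rules f ++ rules g)
  | .fix f => rFix0 f :: rFix1 f :: rules f

/-- The distinguished constraint. -/
def goalT (c : Code) : TGD :=
  ⟨[mkA 7 [0], mkA 3 [1], mkA 4 [0, 1, 2], mkA (eN c) [2, 3]], [mkA 8 []]⟩

/-! ### Soundness -/

/-- The standard model with domain `List ℕ`. -/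
def Mo (k : ℕ) : RelSym → List (List ℕ) → Prop
  | (0, _), [_] => True
  | (1, _), [n] => n.headI = 0
  | (2, _), [n, m] => m.headI = n.headI + 1
  | (3, _), [a] => a = []
  | (4, _), [n, t, a] => a = n.headI :: t
  | (5, _), [a, n] => n.headI = a.headI
  | (6, _), [a, t] => t = a.tail
  | (7, _), [a] => a.headI = k
  | (m + 9, _), [a, b] => ∃ c, enc c = m ∧ b ∈ c.eval a
  | _, _ => False

theorem Mo0 (k r : ℕ) (a : List ℕ) : Mo k (0, r) [a] ↔ True := Iff.rfl
theorem Mo1 (k r : ℕ) (n : List ℕ) : Mo k (1, r) [n] ↔ n.headI = 0 := Iff.rfl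
theorem Mo2 (k r : ℕ) (n m : List ℕ) : Mo k (2, r) [n, m] ↔ m.headI = n.headI + 1 := Iff.rfl
theorem Mo3 (k r : ℕ) (a : List ℕ) : Mo k (3, r) [a] ↔ a = [] := Iff.rfl
theorem Mo4 (k r : ℕ) (n t a : List ℕ) : Mo k (4, r) [n, t, a] ↔ a = n.headI :: t := Iff.rfl
theorem Mo5 (k r : ℕ) (a n : List ℕ) : Mo k (5, r) [a, n] ↔ n.headI = a.headI := Iff.rfl
theorem Mo6 (k r : ℕ) (a t : List ℕ) : Mo k (6, r) [a, t] ↔ t = a.tail := Iff.rfl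
theorem Mo7 (k r : ℕ) (a : List ℕ) : Mo k (7, r) [a] ↔ a.headI = k := Iff.rfl
theorem Mo8 (k r : ℕ) : Mo k (8, r) [] ↔ False := Iff.rfl

theorem Mo_eN (k r : ℕ) (c : Code) (a b : List ℕ) : Mo k (eN c, r) [a, b] ↔ b ∈ c.eval a := by
  simp only [eN, Mo]
  exact ⟨fun ⟨d, hd, h⟩ => enc_inj d c hd ▸ h, fun h => ⟨c, rfl, h⟩⟩

/-- Term evaluation in the model. -/
def tev (μ : ℕ → List ℕ) : Term → List ℕ
  | .var v => μ v
  | .const c => [c]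

/-- Truth of an atom in the model. -/
def At (k : ℕ) (μ : ℕ → List ℕ) (A : Atom) : Prop := Mo k A.rel (A.args.map (tev μ))

theorem At_mkA (k : ℕ) (μ : ℕ → List ℕ) (r : ℕ) (l : List ℕ) :
    At k μ (mkA r l) ↔ Mo k (r, l.length) (l.map μ) := by
  simp [At, mkA, Function.comp_def, tev]

/-- A TGD holds in the model. -/
def SoundT (k : ℕ) (t : TGD) : Prop :=
  ∀ μ, (∀ A ∈ t.body, At k μ A) →
    ∃ μ' : ℕ → List ℕ, (∀ v ∈ varsOf t.body, μ' v = μ v) ∧ ∀ A ∈ t.head, At k μ' A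

/-- An instance maps homomorphically into the model. -/
def SoundI (k : ℕ) (J : Set Fact) : Prop :=
  ∃ h : Val → List ℕ, (∀ c, h (.const c) = [c]) ∧ ∀ F ∈ J, Mo k F.rel (F.args.map h)

theorem Mo_inst {k : ℕ} {h : Val → List ℕ} (hc : ∀ c, h (.const c) = [c]) (ν : ℕ → Val)
    (A : Atom) : Mo k (A.inst ν).rel ((A.inst ν).args.map h) ↔ At k (fun v => h (ν v)) A := by
  have : (A.args.map (Term.eval ν)).map h = A.args.map (tev fun v => h (ν v)) := by
    rw [List.map_map]
    apply List.map_congr_left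
    intro t _
    cases t <;> simp [Term.eval, tev, hc]
  unfold At
  rw [← this]
  rfl

theorem sound_step {k : ℕ} {t : TGD} (ht : SoundT k t) {ν : ℕ → Val} {I J : Set Fact}
    (hI : SoundI k I) (hs : (Constraint.tgd t).chaseStep ν I J) : SoundI k J := by
  obtain ⟨h, hc, hF⟩ := hI
  obtain ⟨hn, ν', hag, hfr, hinj, rfl⟩ := hs
  have hb : bodyHolds I t.body ν := by
    by_contra hb
    exact hn fun h => absurd h hb
  obtain ⟨μ, hμ, hhd⟩ := ht (fun v => h (ν v)) fun A hA => (Mo_inst hc ν A).1 (hF _ (hb A hA))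
  classical
  let h' : Val → List ℕ := fun a =>
    if e : ∃ x, x ∈ t.exVars ∧ ν' x = a then μ e.choose else h a
  have h'ex : ∀ x ∈ t.exVars, h' (ν' x) = μ x := by
    intro x hx
    have e : ∃ y, y ∈ t.exVars ∧ ν' y = ν' x := ⟨x, hx, rfl⟩
    simp only [h', dif_pos e]
    congr 1
    exact hinj _ e.choose_spec.1 _ hx e.choose_spec.2
  have h'old : ∀ a, a ∈ adom I → h' a = h a := by
    intro a ha
    have e : ¬ ∃ y, y ∈ t.exVars ∧ ν' y = a := by
      rintro ⟨y, hy, rfl⟩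
      exact (hfr y hy).2 ha
    simp only [h', dif_neg e]
  have h'c : ∀ c, h' (.const c) = [c] := by
    intro c
    have e : ¬ ∃ y, y ∈ t.exVars ∧ ν' y = Val.const c := by
      rintro ⟨y, hy, e⟩
      have := (hfr y hy).1
      rw [e] at this
      exact this
    simp only [h', dif_neg e, hc]
  refine ⟨h', h'c, ?_⟩
  rintro F (hFI | ⟨A, hA, rfl⟩)
  · have : F.args.map h' = F.args.map h :=
      List.map_congr_left fun a ha => h'old a ⟨F, hFI, ha⟩
    rw [this]
    exact hF F hFI
  · rw [Mo_inst h'c]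
    have : A.args.map (tev fun v => h' (ν' v)) = A.args.map (tev μ) := by
      apply List.map_congr_left
      intro x hx
      cases x with
      | const c => rfl
      | var v =>
        simp only [tev]
        by_cases hv : v ∈ varsOf t.body
        · rw [hag v hv, hμ v hv]
          apply h'old
          obtain ⟨B, hB, hvB⟩ := hv
          exact ⟨_, hb B hB, List.mem_map.2 ⟨_, hvB, rfl⟩⟩
        · exact h'ex v ⟨⟨A, hA, hx⟩, hv⟩
    unfold At
    rw [this]
    exact hhd A hA

theorem soundT_full {k : ℕ} {t : TGD}
    (h : ∀ μ, (∀ A ∈ t.body, At k μ A) → ∀ A ∈ t.head, At k μ A) : SoundT k t :=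
  fun μ hb => ⟨μ, fun _ _ => rfl, h μ hb⟩

theorem sound_base (k : ℕ) : ∀ t ∈ baseRules, SoundT k t := by
  intro t ht
  simp only [baseRules, List.mem_cons, List.not_mem_nil, or_false] at ht
  rcases ht with rfl | rfl | rfl | rfl | rfl | rfl
  · intro μ _
    exact ⟨fun _ => [], by simp [rZ, varsOf], by simp [rZ, At_mkA, Mo0, Mo1, Mo2, Mo3, Mo4, Mo5, Mo6, Mo7, Mo_eN]⟩
  · intro μ _
    refine ⟨Function.update μ 1 [(μ 0).headI + 1], ?_, by simp [rS, At_mkA, Mo0, Mo1, Mo2, Mo3, Mo4, Mo5, Mo6, Mo7, Mo_eN]⟩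
    simp [rS, varsOf, Atom.vars, mkA]
  · intro μ _
    exact ⟨fun _ => [], by simp [rN, varsOf], by simp [rN, At_mkA, Mo0, Mo1, Mo2, Mo3, Mo4, Mo5, Mo6, Mo7, Mo_eN]⟩
  · intro μ _
    refine ⟨Function.update μ 2 ((μ 0).headI :: μ 1), ?_, by simp [rC, At_mkA, Mo0, Mo1, Mo2, Mo3, Mo4, Mo5, Mo6, Mo7, Mo_eN]⟩
    simp [rC, varsOf, Atom.vars, mkA]
  · apply soundT_full
    intro μ
    simp +contextual [rH0, At_mkA, Mo0, Mo1, Mo2, Mo3, Mo4, Mo5, Mo6, Mo7, Mo_eN]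
  · apply soundT_full
    intro μ
    simp +contextual [rH1, At_mkA, Mo0, Mo1, Mo2, Mo3, Mo4, Mo5, Mo6, Mo7, Mo_eN]

theorem sound_rules (k : ℕ) (c : Code) : ∀ t ∈ rules c, SoundT k t := by
  induction c with
  | zero' =>
    simp only [rules, List.mem_singleton, forall_eq]
    apply soundT_full
    intro μ
    simp +contextual [rZero, At_mkA, Mo0, Mo1, Mo2, Mo3, Mo4, Mo5, Mo6, Mo7, Mo_eN]
  | succ =>
    simp only [rules, List.mem_singleton, forall_eq]
    apply soundT_full
    intro μ
    simp +contextual [rSucc, At_mkA, Mo0, Mo1, Mo2, Mo3, Mo4, Mo5, Mo6, Mo7, Mo_eN]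
  | tail =>
    simp only [rules, List.mem_singleton, forall_eq]
    apply soundT_full
    intro μ
    simp +contextual [rTail, At_mkA, Mo0, Mo1, Mo2, Mo3, Mo4, Mo5, Mo6, Mo7, Mo_eN]
  | cons f g hf hg =>
    intro t ht
    simp only [rules, List.mem_cons, List.mem_append] at ht
    rcases ht with rfl | ht | ht
    · apply soundT_full
      intro μ
      simp only [rCons, At_mkA, Mo0, Mo1, Mo2, Mo3, Mo4, Mo5, Mo6, Mo7, Mo_eN, List.forall_mem_cons, List.map, List.length]
      rintro ⟨h1, h2, h3, h4, -⟩
      refine ⟨?_, by simp⟩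
      simp only [Code.cons_eval, Part.bind_eq_bind, Part.mem_bind_iff]
      exact ⟨_, h1, _, h3, by simp [h4, h2]⟩
    · exact hf t ht
    · exact hg t ht
  | comp f g hf hg =>
    intro t ht
    simp only [rules, List.mem_cons, List.mem_append] at ht
    rcases ht with rfl | ht | ht
    · apply soundT_full
      intro μ
      simp only [rComp, At_mkA, Mo0, Mo1, Mo2, Mo3, Mo4, Mo5, Mo6, Mo7, Mo_eN, List.forall_mem_cons, List.map, List.length]
      rintro ⟨h1, h2, -⟩
      refine ⟨?_, by simp⟩
      rw [Code.comp_eval]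
      exact Part.mem_bind_iff.2 ⟨_, h1, h2⟩
    · exact hf t ht
    · exact hg t ht
  | case f g hf hg =>
    intro t ht
    simp only [rules, List.mem_cons, List.mem_append] at ht
    rcases ht with rfl | rfl | ht | ht
    · apply soundT_full
      intro μ
      simp only [rCase0, At_mkA, Mo0, Mo1, Mo2, Mo3, Mo4, Mo5, Mo6, Mo7, Mo_eN, List.forall_mem_cons, List.map, List.length]
      rintro ⟨h1, h2, h3, h4, -⟩
      refine ⟨?_, by simp⟩
      rw [h2] at h1
      simp only [Code.case_eval, ← h1]
      rw [← h3]
      exact h4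
    · apply soundT_full
      intro μ
      simp only [rCase1, At_mkA, Mo0, Mo1, Mo2, Mo3, Mo4, Mo5, Mo6, Mo7, Mo_eN, List.forall_mem_cons, List.map, List.length]
      rintro ⟨h1, h2, h3, h4, h5, -⟩
      refine ⟨?_, by simp⟩
      rw [h2] at h1
      simp only [Code.case_eval, ← h1]
      rw [← h3, ← h4]
      exact h5
    · exact hf t ht
    · exact hg t ht
  | fix f hf =>
    intro t ht
    simp only [rules, List.mem_cons] at ht
    rcases ht with rfl | rfl | ht
    · apply soundT_full
      intro μ
      simp only [rFix0, At_mkA, Mo0, Mo1, Mo2, Mo3, Mo4, Mo5, Mo6, Mo7, Mo_eN, List.forall_mem_cons, List.map, List.length]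
      rintro ⟨h1, h2, h3, h4, -⟩
      refine ⟨?_, by simp⟩
      rw [Code.fix_eval]
      refine PFun.mem_fix_iff.2 ?_
      left
      refine (Part.mem_map_iff _).2 ?_
      refine ⟨_, h1, ?_⟩
      rw [if_pos (by omega), h4]
    · apply soundT_full
      intro μ
      simp only [rFix1, At_mkA, Mo0, Mo1, Mo2, Mo3, Mo4, Mo5, Mo6, Mo7, Mo_eN, List.forall_mem_cons, List.map, List.length]
      rintro ⟨h1, h2, h3, h4, h5, -⟩
      refine ⟨?_, by simp⟩
      rw [Code.fix_eval]
      refine PFun.mem_fix_iff.2 ?_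
      right
      refine ⟨μ 4, ?_, by rwa [Code.fix_eval] at h5⟩
      refine (Part.mem_map_iff _).2 ?_
      refine ⟨_, h1, ?_⟩
      rw [if_neg (by omega), h4]
    · exact hf t ht

/-! ### Completeness -/

/-- Finite chase with the TGDs in `B`. -/
def Ext (B : List TGD) : Finset Fact → Finset Fact → Prop :=
  Relation.ReflTransGen fun J J' => ∃ t ∈ B, ∃ ν, (Constraint.tgd t).chaseStep ν ↑J ↑J'

theorem Ext.mono {B : List TGD} {J J' : Finset Fact} (h : Ext B J J') : J ⊆ J' := by
  induction h with
  | refl => exact Finset.Subset.refl _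
  | tail _ h ih =>
    obtain ⟨t, _, ν, _, ν', _, _, _, e⟩ := h
    refine ih.trans ?_
    rw [← Finset.coe_subset, e]
    exact Set.subset_union_left

theorem Ext.trans {B : List TGD} {J J' J'' : Finset Fact} (h : Ext B J J') (h' : Ext B J' J'') :
    Ext B J J'' := Relation.ReflTransGen.trans h h'

theorem Ext.refl {B : List TGD} (J : Finset Fact) : Ext B J J := Relation.ReflTransGen.refl

theorem exists_fresh (J : Finset Fact) : ∃ N, ∀ m, Val.null (N + m) ∉ adom (↑J : Set Fact) := by
  have hfin : (adom (↑J : Set Fact)).Finite := by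
    have : adom (↑J : Set Fact) = ⋃ F ∈ J, {v | v ∈ F.args} := by
      ext v; simp [adom]
    rw [this]
    exact J.finite_toSet.biUnion fun F _ => F.args.finite_toSet
  have hfin' : (Val.null ⁻¹' adom (↑J : Set Fact)).Finite :=
    hfin.preimage (fun a _ b _ h => by injection h)
  obtain ⟨N, hN⟩ := hfin'.bddAbove
  refine ⟨N + 1, fun m hm => ?_⟩
  have := hN hm
  omega

theorem fire {B : List TGD} {t : TGD} (ht : t ∈ B) (J : Finset Fact) (ν : ℕ → Val)
    (hb : ∀ A ∈ t.body, A.inst ν ∈ J) :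
    ∃ J', Ext B J J' ∧ ∃ ν' : ℕ → Val, (∀ v ∈ varsOf t.body, ν' v = ν v) ∧
      ∀ A ∈ t.head, A.inst ν' ∈ J' := by
  classical
  by_cases hs : (Constraint.tgd t).satAt (↑J) ν
  · obtain ⟨ν', h1, h2⟩ := hs hb
    exact ⟨J, .refl J, ν', h1, h2⟩
  · obtain ⟨N, hN⟩ := exists_fresh J
    let ν' : ℕ → Val := fun v => if v ∈ varsOf t.body then ν v else .null (N + v)
    have hag : ∀ v ∈ varsOf t.body, ν' v = ν v := fun v hv => if_pos hv
    have hex : ∀ v ∈ t.exVars, ν' v = .null (N + v) := fun v hv => if_neg hv.2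
    refine ⟨J ∪ (t.head.map (Atom.inst ν')).toFinset, ?_, ν', hag, ?_⟩
    · refine Relation.ReflTransGen.single ⟨t, ht, ν, hs, ν', hag, ?_, ?_, ?_⟩
      · intro v hv
        rw [hex v hv]
        exact ⟨trivial, hN v⟩
      · intro v hv w hw e
        rw [hex v hv, hex w hw] at e
        injection e with e
        omega
      · ext F
        simp [eq_comm]
    · intro A hA
      rw [Finset.mem_union, List.mem_toFinset]
      exact Or.inr (List.mem_map.2 ⟨A, hA, rfl⟩)

/-- Assignment given by a list of values. -/
def asg (l : List Val) : ℕ → Val := fun i => l.getD i (.null 0)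

/-- `n` represents the number `k` in `J`. -/
def NRep (J : Finset Fact) : ℕ → Val → Prop
  | 0, n => mkF 1 [n] ∈ J ∧ mkF 0 [n] ∈ J
  | k + 1, n => (∃ m, NRep J k m ∧ mkF 2 [m, n] ∈ J) ∧ mkF 0 [n] ∈ J

/-- `a` represents the list `l` in `J`. -/
def LRep (J : Finset Fact) : List ℕ → Val → Prop
  | [], a => mkF 3 [a] ∈ J ∧ mkF 0 [a] ∈ J
  | k :: l, a => (∃ n t, NRep J k n ∧ LRep J l t ∧ mkF 4 [n, t, a] ∈ J) ∧ mkF 0 [a] ∈ J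

theorem NRep.mono {J J' : Finset Fact} (h : J ⊆ J') : ∀ {k n}, NRep J k n → NRep J' k n
  | 0, _, hn => ⟨h hn.1, h hn.2⟩
  | _ + 1, _, ⟨⟨m, h1, h2⟩, h3⟩ => ⟨⟨m, NRep.mono h h1, h h2⟩, h h3⟩

theorem LRep.mono {J J' : Finset Fact} (h : J ⊆ J') : ∀ {l a}, LRep J l a → LRep J' l a
  | [], _, hn => ⟨h hn.1, h hn.2⟩
  | _ :: _, _, ⟨⟨n, t, h1, h2, h3⟩, h4⟩ => ⟨⟨n, t, h1.mono h, LRep.mono h h2, h h3⟩, h h4⟩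

theorem NRep.dom {J : Finset Fact} : ∀ {k n}, NRep J k n → mkF 0 [n] ∈ J
  | 0, _, hn => hn.2
  | _ + 1, _, hn => hn.2

theorem LRep.dom {J : Finset Fact} : ∀ {l a}, LRep J l a → mkF 0 [a] ∈ J
  | [], _, hn => hn.2
  | _ :: _, _, hn => hn.2

section
variable {B : List TGD}

/-- Firing a full rule. -/
theorem fire_full {t : TGD} (ht : t ∈ B) (J : Finset Fact) (ν : ℕ → Val)
    (hv : ∀ A ∈ t.head, ∀ x ∈ A.args, ∃ v ∈ varsOf t.body, x = .var v)
    (hb : ∀ A ∈ t.body, A.inst ν ∈ J) :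
    ∃ J', Ext B J J' ∧ ∀ A ∈ t.head, A.inst ν ∈ J' := by
  obtain ⟨J', e, ν', h1, h2⟩ := fire ht J ν hb
  refine ⟨J', e, fun A hA => ?_⟩
  have : A.inst ν = A.inst ν' := by
    unfold Atom.inst
    congr 1
    apply List.map_congr_left
    intro x hx
    obtain ⟨v, hv, rfl⟩ := hv A hA x hx
    exact (h1 v hv).symm
  rw [this]
  exact h2 A hA

theorem getZ (hB : baseRules ⊆ B) (J : Finset Fact) :
    ∃ J', Ext B J J' ∧ ∃ z, NRep J' 0 z := by
  obtain ⟨J', e, ν, -, h⟩ := fire (t := rZ) (hB (by simp [baseRules])) J (asg []) (by simp [rZ])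
  refine ⟨J', e, ν 0, ?_⟩
  simpa [rZ, inst_mkA, NRep] using h

theorem getN (hB : baseRules ⊆ B) (J : Finset Fact) :
    ∃ J', Ext B J J' ∧ ∃ z, mkF 3 [z] ∈ J' ∧ LRep J' [] z := by
  obtain ⟨J', e, ν, -, h⟩ := fire (t := rN) (hB (by simp [baseRules])) J (asg []) (by simp [rN])
  have h' : mkF 3 [ν 0] ∈ J' ∧ mkF 0 [ν 0] ∈ J' := by simpa [rN, inst_mkA] using h
  exact ⟨J', e, ν 0, h'.1, h'⟩

theorem getS (hB : baseRules ⊆ B) {J : Finset Fact} {k : ℕ} {n : Val} (hn : NRep J k n) :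
    ∃ J', Ext B J J' ∧ ∃ m, mkF 2 [n, m] ∈ J' ∧ NRep J' (k + 1) m := by
  obtain ⟨J', e, ν, hν, h⟩ := fire (t := rS) (hB (by simp [baseRules])) J (asg [n])
    (by simpa [rS, inst_mkA, asg] using hn.dom)
  have h0 : ν 0 = n := hν 0 (by simp [rS, varsOf, Atom.vars, mkA])
  have h' : mkF 2 [n, ν 1] ∈ J' ∧ mkF 0 [ν 1] ∈ J' := by simpa [rS, inst_mkA, h0] using h
  exact ⟨J', e, ν 1, h'.1, ⟨n, hn.mono e.mono, h'.1⟩, h'.2⟩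

theorem getC (hB : baseRules ⊆ B) {J : Finset Fact} {k : ℕ} {l : List ℕ} {n t : Val}
    (hn : NRep J k n) (ht : LRep J l t) :
    ∃ J', Ext B J J' ∧ ∃ a, mkF 4 [n, t, a] ∈ J' ∧ LRep J' (k :: l) a := by
  obtain ⟨J', e, ν, hν, h⟩ := fire (t := rC) (hB (by simp [baseRules])) J (asg [n, t])
    (by simpa [rC, inst_mkA, asg] using ⟨hn.dom, ht.dom⟩)
  have h0 : ν 0 = n := hν 0 (by simp [rC, varsOf, Atom.vars, mkA])
  have h1 : ν 1 = t := hν 1 (by simp [rC, varsOf, Atom.vars, mkA])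
  have h' : mkF 4 [n, t, ν 2] ∈ J' ∧ mkF 0 [ν 2] ∈ J' := by
    simpa [rC, inst_mkA, h0, h1] using h
  exact ⟨J', e, ν 2, h'.1, ⟨n, t, hn.mono e.mono, ht.mono e.mono, h'.1⟩, h'.2⟩

theorem getH (hB : baseRules ⊆ B) {J : Finset Fact} {l : List ℕ} {a : Val} (ha : LRep J l a) :
    ∃ J', Ext B J J' ∧ ∃ n t, mkF 5 [a, n] ∈ J' ∧ NRep J' l.headI n ∧
      mkF 6 [a, t] ∈ J' ∧ LRep J' l.tail t := by
  cases l with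
  | nil =>
    obtain ⟨J1, e1, z, hz⟩ := getZ hB J
    obtain ⟨J2, e2, h⟩ := fire_full (t := rH0) (hB (by simp [baseRules])) J1 (asg [a, z])
      (by simp [rH0, varsOf, Atom.vars, mkA])
      (by simpa [rH0, inst_mkA, asg] using ⟨e1.mono ha.1, hz.1⟩)
    have h' : mkF 5 [a, z] ∈ J2 ∧ mkF 6 [a, a] ∈ J2 := by simpa [rH0, inst_mkA, asg] using h
    exact ⟨J2, e1.trans e2, z, a, h'.1, hz.mono e2.mono, h'.2, ha.mono (e1.trans e2).mono⟩
  | cons k l =>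
    obtain ⟨⟨n, t, h1, h2, h3⟩, -⟩ := ha
    obtain ⟨J2, e2, h⟩ := fire_full (t := rH1) (hB (by simp [baseRules])) J (asg [n, t, a])
      (by simp [rH1, varsOf, Atom.vars, mkA])
      (by simpa [rH1, inst_mkA, asg] using h3)
    have h' : mkF 5 [a, n] ∈ J2 ∧ mkF 6 [a, t] ∈ J2 := by simpa [rH1, inst_mkA, asg] using h
    exact ⟨J2, e2, n, t, h'.1, h1.mono e2.mono, h'.2, h2.mono e2.mono⟩

/-- The chase can derive the value of `c` at `l` from every representation of `l`. -/
def Compl (B : List TGD) (c : Code) (l y : List ℕ) : Prop :=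
  ∀ (J : Finset Fact) (a : Val), LRep J l a →
    ∃ J', Ext B J J' ∧ ∃ b, mkF (eN c) [a, b] ∈ J' ∧ LRep J' y b

theorem complete (hB : baseRules ⊆ B) (c : Code) (hc : rules c ⊆ B) :
    ∀ l y, y ∈ c.eval l → Compl B c l y := by
  induction c with
  | zero' =>
    intro l y hy J a ha
    have hy : y = 0 :: l := by simpa using hy
    subst hy
    obtain ⟨J1, e1, z, hz⟩ := getZ hB J
    obtain ⟨J2, e2, b, hb, hb'⟩ := getC hB hz (ha.mono e1.mono)
    obtain ⟨J3, e3, h⟩ := fire_full (t := rZero) (hc (by simp [rules])) J2 (asg [z, a, b])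
      (by simp [rZero, varsOf, Atom.vars, mkA])
      (by simpa [rZero, inst_mkA, asg] using ⟨e2.mono hz.1, hb⟩)
    exact ⟨J3, (e1.trans e2).trans e3, b, by simpa [rZero, inst_mkA, asg] using h,
      hb'.mono e3.mono⟩
  | succ =>
    intro l y hy J a ha
    have hy : y = [l.headI + 1] := by simpa using hy
    subst hy
    obtain ⟨J1, e1, n, t, h1, hn, -, -⟩ := getH hB ha
    obtain ⟨J2, e2, m, h2, hm⟩ := getS hB hn
    obtain ⟨J3, e3, e, h3, he⟩ := getN hB J2
    obtain ⟨J4, e4, b, h4, hb⟩ := getC hB (hm.mono e3.mono) he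
    obtain ⟨J5, e5, h⟩ := fire_full (t := rSucc) (hc (by simp [rules])) J4 (asg [a, n, m, e, b])
      (by simp [rSucc, varsOf, Atom.vars, mkA])
      (by simpa [rSucc, inst_mkA, asg] using
        ⟨((e2.trans e3).trans e4).mono h1, (e3.trans e4).mono h2, e4.mono h3, h4⟩)
    exact ⟨J5, (((e1.trans e2).trans e3).trans e4).trans e5, b,
      by simpa [rSucc, inst_mkA, asg] using h, hb.mono e5.mono⟩
  | tail =>
    intro l y hy J a ha
    have hy : y = l.tail := by simpa using hy
    subst hy
    obtain ⟨J1, e1, n, t, -, -, h1, ht⟩ := getH hB ha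
    obtain ⟨J2, e2, h⟩ := fire_full (t := rTail) (hc (by simp [rules])) J1 (asg [a, t])
      (by simp [rTail, varsOf, Atom.vars, mkA])
      (by simpa [rTail, inst_mkA, asg] using h1)
    exact ⟨J2, e1.trans e2, t, by simpa [rTail, inst_mkA, asg] using h, ht.mono e2.mono⟩
  | cons f g hf hg =>
    intro l y hy J a ha
    simp only [rules, List.cons_subset, List.append_subset] at hc
    simp only [Code.cons_eval, Part.bind_eq_bind, Part.mem_bind_iff] at hy
    obtain ⟨u, hu, v, hv, hy⟩ := hy
    have hy : y = u.headI :: v := by simpa using hy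
    subst hy
    obtain ⟨J1, e1, b, h1, hb⟩ := hf hc.2.1 _ _ hu J a ha
    obtain ⟨J2, e2, n, t, h2, hn, -, -⟩ := getH hB hb
    obtain ⟨J3, e3, d, h3, hd⟩ := hg hc.2.2 _ _ hv J2 a (ha.mono (e1.trans e2).mono)
    obtain ⟨J4, e4, e, h4, he⟩ := getC hB (hn.mono e3.mono) hd
    obtain ⟨J5, e5, h⟩ := fire_full hc.1 J4 (asg [a, b, n, d, e])
      (by simp [rCons, varsOf, Atom.vars, mkA])
      (by simpa [rCons, inst_mkA, asg] using
        ⟨((e2.trans e3).trans e4).mono h1, (e3.trans e4).mono h2, e4.mono h3, h4⟩)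
    exact ⟨J5, (((e1.trans e2).trans e3).trans e4).trans e5, e,
      by simpa [rCons, inst_mkA, asg] using h, he.mono e5.mono⟩
  | comp f g hf hg =>
    intro l y hy J a ha
    simp only [rules, List.cons_subset, List.append_subset] at hc
    rw [Code.comp_eval] at hy
    obtain ⟨u, hu, hy⟩ := Part.mem_bind_iff.1 hy
    obtain ⟨J1, e1, b, h1, hb⟩ := hg hc.2.2 _ _ hu J a ha
    obtain ⟨J2, e2, d, h2, hd⟩ := hf hc.2.1 _ _ hy J1 b hb
    obtain ⟨J3, e3, h⟩ := fire_full hc.1 J2 (asg [a, b, d])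
      (by simp [rComp, varsOf, Atom.vars, mkA])
      (by simpa [rComp, inst_mkA, asg] using ⟨e2.mono h1, h2⟩)
    exact ⟨J3, (e1.trans e2).trans e3, d,
      by simpa [rComp, inst_mkA, asg] using h, hd.mono e3.mono⟩
  | case f g hf hg =>
    intro l y hy J a ha
    simp only [rules, List.cons_subset, List.append_subset] at hc
    simp only [Code.case_eval] at hy
    obtain ⟨J1, e1, n, t, h1, hn, h2, ht⟩ := getH hB ha
    rcases hk : l.headI with _ | k
    · rw [hk] at hy hn
      obtain ⟨J2, e2, b, h3, hb⟩ := hf hc.2.2.1 _ _ hy J1 t ht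
      obtain ⟨J3, e3, h⟩ := fire_full hc.1 J2 (asg [a, n, t, b])
        (by simp [rCase0, varsOf, Atom.vars, mkA])
        (by simpa [rCase0, inst_mkA, asg] using
          ⟨e2.mono h1, e2.mono hn.1, e2.mono h2, h3⟩)
      exact ⟨J3, (e1.trans e2).trans e3, b,
        by simpa [rCase0, inst_mkA, asg] using h, hb.mono e3.mono⟩
    · rw [hk] at hy hn
      obtain ⟨⟨m, hm, hmn⟩, -⟩ := hn
      obtain ⟨J2, e2, d, h3, hd⟩ := getC hB hm ht
      obtain ⟨J3, e3, b, h4, hb⟩ := hg hc.2.2.2 _ _ hy J2 d hd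
      obtain ⟨J4, e4, h⟩ := fire_full hc.2.1 J3 (asg [a, n, m, t, d, b])
        (by simp [rCase1, varsOf, Atom.vars, mkA])
        (by simpa [rCase1, inst_mkA, asg] using
          ⟨(e2.trans e3).mono h1, (e2.trans e3).mono hmn, (e2.trans e3).mono h2, e3.mono h3, h4⟩)
      exact ⟨J4, ((e1.trans e2).trans e3).trans e4, b,
        by simpa [rCase1, inst_mkA, asg] using h, hb.mono e4.mono⟩
  | fix f hf =>
    intro l y hy
    simp only [rules, List.cons_subset] at hc
    rw [Code.fix_eval] at hy
    refine PFun.fixInduction' (C := fun l => Compl B (.fix f) l y) hy ?_ ?_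
    · intro l hl J a ha
      obtain ⟨u, hu, hy⟩ := (Part.mem_map_iff _).1 hl
      split_ifs at hy with hz
      injection hy with hy
      subst hy
      obtain ⟨J1, e1, b, h1, hb⟩ := hf hc.2.2 _ _ hu J a ha
      obtain ⟨J2, e2, n, t, h2, hn, h3, ht⟩ := getH hB hb
      rw [hz] at hn
      obtain ⟨J3, e3, h⟩ := fire_full hc.1 J2 (asg [a, b, n, t])
        (by simp [rFix0, varsOf, Atom.vars, mkA])
        (by simpa [rFix0, inst_mkA, asg] using ⟨e2.mono h1, h2, hn.1, h3⟩)
      exact ⟨J3, (e1.trans e2).trans e3, t,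
        by simpa [rFix0, inst_mkA, asg] using h, ht.mono e3.mono⟩
    · intro l l' _ hl ih J a ha
      obtain ⟨u, hu, hy⟩ := (Part.mem_map_iff _).1 hl
      split_ifs at hy with hz
      injection hy with hy
      subst hy
      obtain ⟨J1, e1, b, h1, hb⟩ := hf hc.2.2 _ _ hu J a ha
      obtain ⟨J2, e2, n, t, h2, hn, h3, ht⟩ := getH hB hb
      obtain ⟨k, hk⟩ := Nat.exists_eq_succ_of_ne_zero hz
      rw [hk] at hn
      obtain ⟨⟨m, hm, hmn⟩, -⟩ := hn
      obtain ⟨J3, e3, d, h4, hd⟩ := ih J2 t ht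
      obtain ⟨J4, e4, h⟩ := fire_full hc.2.1 J3 (asg [a, b, n, m, t, d])
        (by simp [rFix1, varsOf, Atom.vars, mkA])
        (by simpa [rFix1, inst_mkA, asg] using
          ⟨(e2.trans e3).mono h1, e3.mono h2, e3.mono hmn, e3.mono h3, h4⟩)
      exact ⟨J4, ((e1.trans e2).trans e3).trans e4, d,
        by simpa [rFix1, inst_mkA, asg] using h, hd.mono e4.mono⟩

/-- A finite chase yields chase data. -/
theorem Ext.data {J J' : Finset Fact} (h : Ext B J J') :
    ∃ (D : ChaseData) (r : ℕ), D.inst 0 = ↑J ∧ D.inst r = ↑J' ∧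
      ∀ i < r, (∃ t ∈ B, D.cns i = .tgd t) ∧
        (D.cns i).chaseStep (D.asg i) (D.inst i) (D.inst (i + 1)) := by
  induction h with
  | refl => exact ⟨⟨fun _ => ↑J, fun _ => .tgd rZ, fun _ => asg []⟩, 0, rfl, rfl, by simp⟩
  | @tail J1 J2 _ h ih =>
    obtain ⟨D, r, h0, hr, hs⟩ := ih
    obtain ⟨t, ht, ν, hst⟩ := h
    refine ⟨⟨fun i => if i ≤ r then D.inst i else ↑J2, fun i => if i < r then D.cns i else .tgd t,
      fun i => if i < r then D.asg i else ν⟩, r + 1, by simpa using h0, by simp, ?_⟩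
    intro i hi
    by_cases hir : i < r
    · have h1 : i ≤ r := by omega
      have h2 : i + 1 ≤ r := by omega
      simpa [hir, h1, h2] using hs i hir
    · have : i = r := by omega
      subst this
      refine ⟨⟨t, ht, by simp⟩, ?_⟩
      simpa [hr] using hst

end

/-- All base rules. -/
def prog (c : Code) : List TGD := baseRules ++ rules c

/-- The constraint set of the reduction. -/
def sig (c : Code) : List Constraint := .tgd (goalT c) :: (prog c).map .tgd

/-- The input instance. -/
def input (k : ℕ) : List Fact :=
  mkF 7 [.const k] :: mkF 1 [.const 0] ::
    ((List.range (k + 1)).map (fun i => mkF 0 [.const i]) ++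
      (List.range k).map fun i => mkF 2 [.const i, .const (i + 1)])

theorem sound_prog (k : ℕ) (c : Code) : ∀ t ∈ prog c, SoundT k t := by
  intro t ht
  rcases List.mem_append.1 ht with h | h
  · exact sound_base k t h
  · exact sound_rules k c t h

theorem sound_input (k : ℕ) : SoundI k {F | F ∈ input k} := by
  refine ⟨fun v => match v with | .const c => [c] | .null _ => [], fun _ => rfl, ?_⟩
  intro F hF
  simp only [input, Set.mem_ofPred_eq, List.mem_cons, List.mem_append, List.mem_map] at hF
  rcases hF with rfl | rfl | ⟨i, _, rfl⟩ | ⟨i, _, rfl⟩ <;> simp [mkF, Mo0, Mo1, Mo2, Mo3, Mo4, Mo5, Mo6, Mo7, Mo_eN, Mo8]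

theorem sound_goal {k : ℕ} {c : Code} {I J : Set Fact} {ν : ℕ → Val} (hI : SoundI k I)
    (hs : (Constraint.tgd (goalT c)).chaseStep ν I J) : (c.eval [k]).Dom := by
  obtain ⟨h, hc, hF⟩ := hI
  have hb : bodyHolds I (goalT c).body ν := by
    by_contra hb
    exact hs.1 fun h => absurd h hb
  have := fun A hA => (Mo_inst hc ν A).1 (hF _ (hb A hA))
  simp only [goalT, At_mkA, Mo0, Mo1, Mo2, Mo3, Mo4, Mo5, Mo6, Mo7, Mo_eN, List.forall_mem_cons, List.map, List.length] at this
  obtain ⟨h1, h2, h3, h4, -⟩ := this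
  rw [h1, h2] at h3
  rw [h3] at h4
  exact Part.dom_iff_mem.2 ⟨_, h4⟩

theorem nrep_input (k : ℕ) : ∀ i ≤ k, NRep (input k).toFinset i (.const i) := by
  intro i
  induction i with
  | zero => intro _; simp [NRep, input, mkF]
  | succ i ih =>
    intro hi
    refine ⟨⟨_, ih (by omega), ?_⟩, ?_⟩
    · simp only [input, List.mem_toFinset, List.mem_cons, List.mem_append, List.mem_map,
        List.mem_range]
      exact Or.inr (Or.inr (Or.inr ⟨i, by omega, rfl⟩))
    · simp only [input, List.mem_toFinset, List.mem_cons, List.mem_append, List.mem_map,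
        List.mem_range]
      exact Or.inr (Or.inr (Or.inl ⟨i + 1, by omega, rfl⟩))

theorem ext_sound {k : ℕ} {c : Code} {J J' : Finset Fact} (h : Ext (prog c) J J')
    (hJ : SoundI k ↑J) : SoundI k ↑J' := by
  induction h with
  | refl => exact hJ
  | tail _ h ih =>
    obtain ⟨t, ht, ν, hs⟩ := h
    exact sound_step (sound_prog k c t ht) ih hs

theorem reduction (c : Code) (k : ℕ) :
    (c.eval [k]).Dom ↔
      ¬ Irrelevant {F | F ∈ input k} {α | α ∈ sig c} (.tgd (goalT c)) := by
  unfold Irrelevant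
  rw [not_not]
  constructor
  · intro h
    obtain ⟨y, hy⟩ := Part.dom_iff_mem.1 h
    have hB : baseRules ⊆ prog c := List.subset_append_left _ _
    have hc : rules c ⊆ prog c := List.subset_append_right _ _
    have hk := nrep_input k k le_rfl
    obtain ⟨J1, e1, e, h1, he⟩ := getN hB (input k).toFinset
    obtain ⟨J2, e2, a, h2, ha⟩ := getC hB (hk.mono e1.mono) he
    obtain ⟨J3, e3, b, h3, hb⟩ := complete hB c hc _ _ hy J2 a ha
    have e123 := (e1.trans e2).trans e3
    have hin : (↑(input k).toFinset : Set Fact) = {F | F ∈ input k} := by ext; simp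
    have hs : SoundI k (↑J3 : Set Fact) := ext_sound e123 (hin ▸ sound_input k)
    have hno : mkF 8 [] ∉ J3 := by
      intro hm
      obtain ⟨h, -, hF⟩ := hs
      have := hF _ hm
      simp [mkF, Mo0, Mo1, Mo2, Mo3, Mo4, Mo5, Mo6, Mo7, Mo_eN, Mo8] at this
    have hin7 : mkF 7 [.const k] ∈ J3 := e123.mono (by simp [input])
    have hbody : bodyHolds (↑J3) (goalT c).body (asg [.const k, e, a, b]) := by
      simpa [bodyHolds, goalT, inst_mkA, asg] using
        ⟨hin7, (e2.trans e3).mono h1, e3.mono h2, h3⟩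
    obtain ⟨D, r, h0, hr, hst⟩ := e123.data
    refine ⟨⟨fun i => if i ≤ r then D.inst i else ↑J3 ∪ {mkF 8 []},
      fun i => if i < r then D.cns i else .tgd (goalT c),
      fun i => if i < r then D.asg i else asg [.const k, e, a, b]⟩, r + 1,
      by simpa [hin] using h0, ?_, r, by omega, by simp⟩
    intro i hi
    by_cases hir : i < r
    · have h1 : i ≤ r := by omega
      have h2 : i + 1 ≤ r := by omega
      obtain ⟨⟨t, ht, het⟩, hs⟩ := hst i hir
      refine ⟨?_, by simpa [hir, h1, h2] using hs⟩
      simp only [hir, if_true, het, sig, Set.mem_ofPred_eq]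
      exact List.mem_cons_of_mem _ (List.mem_map.2 ⟨t, ht, rfl⟩)
    · have : i = r := by omega
      subst this
      refine ⟨by simp [sig], ?_⟩
      simp only [lt_irrefl, if_false, le_refl, if_true, hr, show ¬ (i + 1 ≤ i) by omega]
      refine ⟨?_, asg [.const k, e, a, b], fun _ _ => rfl, ?_, ?_, ?_⟩
      · intro hsat
        obtain ⟨ν', -, h'⟩ := hsat hbody
        apply hno
        simpa [goalT, bodyHolds, inst_mkA] using h'
      · simp [TGD.exVars, goalT, varsOf, Atom.vars, mkA]
      · simp [TGD.exVars, goalT, varsOf, Atom.vars, mkA]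
      · ext F
        simp [goalT, inst_mkA]
  · rintro ⟨D, r, h0, hok, i, hi, hci⟩
    by_contra hd
    have key : ∀ j ≤ r, SoundI k (D.inst j) := by
      intro j
      induction j with
      | zero => intro _; rw [h0]; exact sound_input k
      | succ j ih =>
        intro hj
        obtain ⟨hm, hs⟩ := hok j (by omega)
        have hj' := ih (by omega)
        simp only [sig, Set.mem_ofPred_eq, List.mem_cons, List.mem_map] at hm
        rcases hm with hm | ⟨t, ht, hm⟩
        · rw [hm] at hs
          exact absurd (sound_goal hj' hs) hd
        · rw [← hm] at hs
          exact sound_step (sound_prog k c t ht) hj' hs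
    have hs := (hok i hi).2
    rw [hci] at hs
    exact hd (sound_goal (key i hi.le) hs)

/-! ### Computability of the reduction -/

theorem primrec_const : Primrec Val.const := by
  have h : Primrec Val.equivSum.symm := Primrec.of_equiv_symm
  exact h.comp Primrec.sumInl

theorem primrec_mkFact : Primrec Fact.equivProd.symm := Primrec.of_equiv_symm

theorem primrec_fact1 (r : ℕ) : Primrec fun i : ℕ => mkF r [.const i] := by
  refine primrec_mkFact.comp (f := Fact.equivProd.symm)
    (g := fun i : ℕ => ((r, 1), [Val.const i])) ?_
  exact (Primrec.const _).pair (Primrec.list_cons.comp primrec_const (Primrec.const []))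

theorem primrec_fact2 (r : ℕ) : Primrec fun i : ℕ => mkF r [.const i, .const (i + 1)] := by
  refine primrec_mkFact.comp (f := Fact.equivProd.symm)
    (g := fun i : ℕ => ((r, 2), [Val.const i, Val.const (i + 1)])) ?_
  exact (Primrec.const _).pair (Primrec.list_cons.comp primrec_const
    (Primrec.list_cons.comp (primrec_const.comp Primrec.succ) (Primrec.const [])))

theorem primrec_input : Primrec input := by
  unfold input
  refine Primrec.list_cons.comp (primrec_fact1 7) (Primrec.list_cons.comp (Primrec.const _) ?_)
  refine Primrec.list_append.comp ?_ ?_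
  · exact Primrec.list_map (Primrec.list_range.comp Primrec.succ)
      ((primrec_fact1 0).comp Primrec.snd).to₂
  · exact Primrec.list_map Primrec.list_range ((primrec_fact2 2).comp Primrec.snd).to₂

/-- A code whose halting set on singleton inputs is the halting problem. -/
theorem exists_universal : ∃ c : Code, ∀ k : ℕ,
    (c.eval [k]).Dom ↔ (Nat.Partrec.Code.eval (Denumerable.ofNat Nat.Partrec.Code k) 0).Dom := by
  have hp : Partrec fun k : ℕ => Nat.Partrec.Code.eval (Denumerable.ofNat Nat.Partrec.Code k) 0 :=
    Nat.Partrec.Code.eval_part.comp (Computable.ofNat _) (Computable.const 0)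
  have hp' := Nat.Partrec'.part_iff₁.2 hp
  obtain ⟨c, hc⟩ := Code.exists_code hp'
  refine ⟨c, fun k => ?_⟩
  have := hc (k ::ᵥ List.Vector.nil)
  have e : c.eval [k] = _ := this
  rw [e]
  simp

end Reduction

/-- Theorem 2. Given a finite set `Σ` of TGDs and EGDs (as a list),
a constraint `α`, and a finite database instance `I` (as a list of facts), it is
undecidable whether `α` is `(I,Σ)`-irrelevant. -/
theorem irrelevance_undecidable :
    ¬ ComputablePred (fun p : List Constraint × Constraint × List Fact =>
        Irrelevant {F | F ∈ p.2.2} {α | α ∈ p.1} p.2.1) := by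
  intro h
  obtain ⟨c, hc⟩ := exists_universal
  apply ComputablePred.halting_problem 0
  have hf : Computable fun d : Nat.Partrec.Code =>
      (sig c, Constraint.tgd (goalT c), input (Encodable.encode d)) :=
    ((Primrec.const _).pair ((Primrec.const _).pair
      (primrec_input.comp Primrec.encode))).to_comp
  refine ComputablePred.of_eq (ComputablePred.computable_of_manyOneReducible
    (⟨_, hf, fun _ => Iff.rfl⟩ : _ ≤₀ _) h.not) ?_
  intro d
  rw [← reduction, hc, Denumerable.ofNat_encode]

end StopChase
end

section
/- Let k be a positive natural number. If there is an infinite chase sequence S when chasing an instance I_0 with a constraint set Σ, then some finite prefix of S is k-cyclic. -/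
set_option maxHeartbeats 1000000

namespace StopChase

/-! ## Proof -/

/-- Head atoms of a constraint. -/
def Constraint.hAtoms : Constraint → List Atom
  | .tgd t => t.head
  | .egd _ => []

lemma mem_adom_of_body {I : Set Fact} {L : List Atom} {ν : ℕ → Val} (h : bodyHolds I L ν)
    {v : ℕ} (hv : v ∈ varsOf L) : ν v ∈ adom I := by
  obtain ⟨A, hA, hvA⟩ := hv
  exact ⟨_, h A hA, List.mem_map.2 ⟨Term.var v, hvA, rfl⟩⟩

lemma egd_step {e : EGD} {ν : ℕ → Val} {I J : Set Fact} (hw : e.wf)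
    (h : (Constraint.egd e).chaseStep ν I J) :
    newNulls I J = ∅ ∧ (∃ a, a.isNull ∧ a ∈ adom I ∧ a ∉ adom J) ∧ (I.Finite → J.Finite) := by
  obtain ⟨hs, a, b, ha, hab, rfl⟩ := h
  simp only [Constraint.satAt, Classical.not_imp] at hs
  obtain ⟨hb, hne⟩ := hs
  have hl := mem_adom_of_body hb hw.2.2.1
  have hr := mem_adom_of_body hb hw.2.2.2
  have h1 : a ∈ ({ν e.lhs, ν e.rhs} : Set Val) := hab ▸ (by simp)
  have h2 : b ∈ ({ν e.lhs, ν e.rhs} : Set Val) := hab ▸ (by simp)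
  have h3 : a ≠ b := by
    rintro rfl
    have h4 : ν e.lhs ∈ ({a, a} : Set Val) := hab ▸ (by simp)
    have h5 : ν e.rhs ∈ ({a, a} : Set Val) := hab ▸ (by simp)
    simp at h4 h5
    exact hne (h4.trans h5.symm)
  have haI : a ∈ adom I := by
    rcases h1 with h | h <;> rw [h] <;> assumption
  have hbI : b ∈ adom I := by
    rcases h2 with h | h <;> rw [h] <;> assumption
  refine ⟨?_, ⟨a, ha, haI, ?_⟩, fun hf => hf.image _⟩
  · ext v
    simp only [newNulls, Set.mem_setOf_eq, Set.mem_empty_iff_false, iff_false]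
    rintro ⟨-, ⟨F, ⟨G, hG, rfl⟩, hv⟩, hn⟩
    simp only [Fact.substF, List.mem_map] at hv
    obtain ⟨w, hw', rfl⟩ := hv
    apply hn
    unfold Val.subst
    split_ifs
    · exact hbI
    · exact ⟨G, hG, hw'⟩
  · rintro ⟨F, ⟨G, hG, rfl⟩, hv⟩
    simp only [Fact.substF, List.mem_map] at hv
    obtain ⟨w, hw', h⟩ := hv
    unfold Val.subst at h
    split_ifs at h with h'
    · exact h3 h.symm
    · exact h' h

/-- What a TGD step does. -/
lemma tgd_step {t : TGD} {ν : ℕ → Val} {I J : Set Fact}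
    (h : (Constraint.tgd t).chaseStep ν I J) :
    ∃ ν' : ℕ → Val, J = I ∪ {F | ∃ A ∈ t.head, F = A.inst ν'} ∧ I ≠ J ∧
      (∀ v ∈ varsOf t.body, ν' v ∈ adom I) ∧
      (∀ v ∈ t.exVars, ν' v ∈ newNulls I J) := by
  obtain ⟨hs, ν', h1, h2, h3, rfl⟩ := h
  simp only [Constraint.satAt, Classical.not_imp] at hs
  obtain ⟨hb, hne⟩ := hs
  refine ⟨ν', rfl, ?_, ?_, ?_⟩
  · intro heq
    refine hne ⟨ν', h1, fun A hA => ?_⟩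
    rw [heq]
    exact Or.inr ⟨A, hA, rfl⟩
  · intro v hv
    rw [h1 v hv]
    exact mem_adom_of_body hb hv
  · intro v hv
    refine ⟨(h2 v hv).1, ?_, (h2 v hv).2⟩
    obtain ⟨A, hA, hvA⟩ := hv.1
    exact ⟨_, Or.inr ⟨A, hA, rfl⟩, List.mem_map.2 ⟨Term.var v, hvA, rfl⟩⟩

lemma finite_inst {t : List Atom} (ν' : ℕ → Val) :
    {F | ∃ A ∈ t, F = A.inst ν'}.Finite := by
  have : {F | ∃ A ∈ t, F = A.inst ν'} = (fun A => A.inst ν') '' {A | A ∈ t} := by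
    ext F; simp [eq_comm]
  rw [this]
  exact (List.finite_toSet t).image _

lemma step_finite {α : Constraint} {ν : ℕ → Val} {I J : Set Fact} (hw : α.wf)
    (h : α.chaseStep ν I J) (hI : I.Finite) : J.Finite := by
  cases α with
  | egd e => exact (egd_step hw h).2.2 hI
  | tgd t =>
    obtain ⟨ν', rfl, -⟩ := tgd_step h
    exact hI.union (finite_inst ν')

lemma adom_finite {I : Set Fact} (hI : I.Finite) : (adom I).Finite := by
  have : adom I = ⋃ F ∈ I, {v | v ∈ F.args} := by
    ext v; simp [adom]
  rw [this]
  exact hI.biUnion fun F _ => List.finite_toSet _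

lemma lists_finite {U : Set Val} (hU : U.Finite) (n : ℕ) :
    {l : List Val | l.length = n ∧ ∀ x ∈ l, x ∈ U}.Finite := by
  have := hU.to_subtype
  refine ((List.finite_length_eq U n).image (List.map Subtype.val)).subset ?_
  rintro l ⟨hl, hx⟩
  refine ⟨l.attach.map fun x => ⟨x.1, hx _ x.2⟩, ?_, ?_⟩
  · simpa using hl
  · simp

lemma heads_finite {Sg : Set Constraint} (hfin : Sg.Finite) :
    {A | ∃ α ∈ Sg, A ∈ α.hAtoms}.Finite := by
  have : {A | ∃ α ∈ Sg, A ∈ α.hAtoms} = ⋃ α ∈ Sg, {A | A ∈ α.hAtoms} := by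
    ext v; simp
  rw [this]
  exact hfin.biUnion fun F _ => List.finite_toSet _

lemma bodies_finite {Sg : Set Constraint} (hfin : Sg.Finite) :
    {A | ∃ α ∈ Sg, A ∈ α.bodyAtoms}.Finite := by
  have : {A | ∃ α ∈ Sg, A ∈ α.bodyAtoms} = ⋃ α ∈ Sg, {A | A ∈ α.bodyAtoms} := by
    ext v; simp
  rw [this]
  exact hfin.biUnion fun F _ => List.finite_toSet _

lemma atomPos_finite {H : Set Atom} (hH : H.Finite) :
    {π : Pos | ∃ A ∈ H, A.rel = π.1 ∧ π.2 < A.args.length}.Finite := by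
  refine (hH.biUnion (t := fun A => (fun i => (A.rel, i)) '' Set.Iio A.args.length)
    fun A _ => (Set.finite_Iio _).image _).subset ?_
  rintro ⟨R, i⟩ ⟨A, hA, h1, h2⟩
  simp only [Set.mem_iUnion]
  exact ⟨A, hA, i, h2, by simp_all⟩

lemma no_stable {Sg : Set Constraint} (hfin : Sg.Finite)
    (hwf : ∀ α ∈ Sg, α.wf) (D : ChaseData) (hI : (D.inst 0).Finite)
    (hok : D.okAll Sg) (N : ℕ) : ∃ n > N, (newNulls (D.inst n) (D.inst (n+1))).Nonempty := by
  by_contra! hno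
  have hF : ∀ i, (D.inst i).Finite := by
    intro i
    induction i with
    | zero => exact hI
    | succ i ih => exact step_finite (hwf _ (hok i).1) (hok i).2 ih
  set nl : ℕ → Set Val := fun i => {v | v.isNull ∧ v ∈ adom (D.inst i)} with hnl
  have hnf : ∀ i, (nl i).Finite := fun i => (adom_finite (hF i)).subset fun v hv => hv.2
  have hsub : ∀ i > N, nl (i+1) ⊆ nl i := by
    rintro i hi v ⟨h1, h2⟩
    refine ⟨h1, ?_⟩
    by_contra h3
    have : v ∈ newNulls (D.inst i) (D.inst (i+1)) := ⟨h1, h2, h3⟩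
    rw [hno i hi] at this
    exact this
  -- choose M > N minimizing the number of nulls
  have hex : ∃ c, ∃ M > N, (nl M).ncard = c := ⟨_, N+1, by omega, rfl⟩
  classical
  obtain ⟨M, hM, hMc⟩ := Nat.find_spec hex
  have hmin : ∀ i > N, Nat.find hex ≤ (nl i).ncard := fun i hi => Nat.find_min' hex ⟨i, hi, rfl⟩
  have hc : ∀ j, (nl (M + j)).ncard = Nat.find hex := by
    intro j
    induction j with
    | zero => exact hMc
    | succ j ih =>
      refine le_antisymm ?_ (hmin _ (by omega))
      rw [← ih]
      exact Set.ncard_le_ncard (hsub (M + j) (by omega)) (hnf _)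
  -- hence only TGD steps without existential variables from M on
  have htgd : ∀ j, ∃ t, D.cns (M + j) = .tgd t := by
    intro j
    have hs := (hok (M + j)).2
    have hw := hwf _ (hok (M + j)).1
    cases hα : D.cns (M + j) with
    | tgd t => exact ⟨t, rfl⟩
    | egd e =>
      exfalso
      rw [hα] at hs hw
      obtain ⟨-, ⟨a, ha, ha1, ha2⟩, -⟩ := egd_step hw hs
      have hlt : (nl (M + j + 1)).ncard < (nl (M + j)).ncard :=
        Set.ncard_lt_ncard ⟨hsub (M + j) (by omega), fun h => ha2 (h ⟨ha, ha1⟩).2⟩ (hnf _)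
      have h1 := hc j
      have h2 := hc (j + 1)
      rw [← add_assoc] at h2
      omega
  set H : Set Atom := {A | ∃ α ∈ Sg, A ∈ α.hAtoms} with hH
  have hHf : H.Finite := heads_finite hfin
  set U : Set Val := adom (D.inst M) ∪
    ⋃ A ∈ H, {v | v ∈ A.args.map (Term.eval (fun _ => Val.const 0))} with hU
  have hUf : U.Finite := (adom_finite (hF M)).union
    (hHf.biUnion fun A _ => List.finite_toSet _)
  set B : Set Fact := D.inst M ∪ ⋃ A ∈ H, (fun l => Fact.mk A.rel l) ''
    {l : List Val | l.length = A.args.length ∧ ∀ x ∈ l, x ∈ U} with hB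
  have hBf : B.Finite := (hF M).union
    (hHf.biUnion fun A _ => (lists_finite hUf _).image _)
  have hinv : ∀ j, D.inst (M + j) ⊆ B ∧ adom (D.inst (M + j)) ⊆ U := by
    intro j
    induction j with
    | zero => exact ⟨Set.subset_union_left, Set.subset_union_left⟩
    | succ j ih =>
      obtain ⟨t, ht⟩ := htgd j
      have hs := (hok (M + j)).2
      have hS := (hok (M + j)).1
      rw [ht] at hs hS
      obtain ⟨ν', hJ, -, hb, hx⟩ := tgd_step hs
      rw [hno _ (by omega)] at hx
      have hAH : ∀ A ∈ t.head, A ∈ H := fun A hA => ⟨_, hS, hA⟩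
      have hval : ∀ A ∈ t.head, ∀ v ∈ (A.inst ν').args, v ∈ U := by
        intro A hA v hv
        simp only [Atom.inst, List.mem_map] at hv
        obtain ⟨s, hs1, rfl⟩ := hv
        cases s with
        | var x =>
          by_cases hxb : x ∈ varsOf t.body
          · exact ih.2 (hb x hxb)
          · exact absurd (hx x ⟨⟨A, hA, hs1⟩, hxb⟩) (by simp)
        | const c =>
          right
          simp only [Set.mem_iUnion]
          exact ⟨A, hAH A hA, List.mem_map.2 ⟨_, hs1, rfl⟩⟩
      rw [← add_assoc, hJ]
      constructor
      · rintro F (hF' | ⟨A, hA, rfl⟩)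
        · exact ih.1 hF'
        · right
          simp only [Set.mem_iUnion]
          exact ⟨A, hAH A hA, _, ⟨by simp [Atom.inst], hval A hA⟩, rfl⟩
      · rintro v ⟨F, (hF' | ⟨A, hA, rfl⟩), hv⟩
        · exact ih.2 ⟨F, hF', hv⟩
        · exact hval A hA v hv
  have hgrow : ∀ j, j ≤ (D.inst (M + j)).ncard := by
    intro j
    induction j with
    | zero => simp
    | succ j ih =>
      obtain ⟨t, ht⟩ := htgd j
      have hs := (hok (M + j)).2
      rw [ht] at hs
      obtain ⟨ν', hJ, hne, -⟩ := tgd_step hs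
      have hss : D.inst (M + j) ⊂ D.inst (M + j + 1) :=
        HasSubset.Subset.ssubset_of_ne (hJ ▸ Set.subset_union_left) hne
      have := Set.ncard_lt_ncard hss (hF _)
      rw [← add_assoc]
      omega
  have h1 := hgrow (B.ncard + 1)
  have h2 := Set.ncard_le_ncard (hinv (B.ncard + 1)).1 hBf
  omega

lemma posOfVal_new {Sg : Set Constraint} {α : Constraint} (hα : α ∈ Sg) (hw : α.wf)
    {ν : ℕ → Val} {I J : Set Fact} (h : α.chaseStep ν I J) {n : Val} (hn : n ∈ newNulls I J) :
    posOfVal J n ⊆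
      {π : Pos | ∃ A ∈ {A | ∃ α ∈ Sg, A ∈ α.hAtoms}, A.rel = π.1 ∧ π.2 < A.args.length} := by
  cases α with
  | egd e => rw [(egd_step hw h).1] at hn; exact absurd hn (by simp)
  | tgd t =>
    obtain ⟨ν', rfl, -⟩ := tgd_step h
    rintro π ⟨F, (hF | ⟨A, hA, rfl⟩), h1, h2⟩
    · exact absurd ⟨F, hF, List.mem_of_getElem? h2⟩ hn.2.2
    · refine ⟨A, ⟨_, hα, hA⟩, h1, ?_⟩
      obtain ⟨h3, -⟩ := List.getElem?_eq_some_iff.1 h2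
      simpa [Atom.inst] using h3

lemma instBodyPos_sub {Sg : Set Constraint} {α : Constraint} (hα : α ∈ Sg)
    (ν : ℕ → Val) (v : Val) : instBodyPos α ν v ⊆
      {π : Pos | ∃ A ∈ {A | ∃ α ∈ Sg, A ∈ α.bodyAtoms}, A.rel = π.1 ∧ π.2 < A.args.length} := by
  rintro π ⟨A, hA, h1, h2⟩
  refine ⟨A, ⟨_, hα, hA⟩, h1, ?_⟩
  obtain ⟨h3, -⟩ := List.getElem?_eq_some_iff.1 h2
  simpa using h3

lemma sublist_range {ψ : ℕ → ℕ} (hψ : StrictMono ψ) (k : ℕ) :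
    ((List.range k).map ψ).Sublist (List.range (ψ k)) := by
  induction k with
  | zero => simp
  | succ k ih =>
    rw [List.range_succ, List.map_append]
    refine (ih.append (List.Sublist.refl _)).trans ?_
    simp only [List.map_cons, List.map_nil]
    rw [← List.range_succ]
    exact List.range_sublist.2 (hψ (Nat.lt_succ_self k))

/-- Lemma 4. Let `k ≥ 1`. If there is an infinite chase sequence
`S` when chasing `I_0` with `Σ`, then some finite prefix of `S` is `k`-cyclic. -/
theorem infinite_chase_has_kCyclic_prefix
    (k : ℕ) (hk : 1 ≤ k) (Sg : Set Constraint) (hfin : Sg.Finite)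
    (hwf : ∀ α ∈ Sg, α.wf) (D : ChaseData) (hI : (D.inst 0).Finite)
    (hok : D.okAll Sg) (hfresh : D.freshAll) :
    ∃ r : ℕ, kCyclic (D.mgE r) k := by
  obtain ⟨φ, hφ, hne⟩ := Nat.exists_strictMono_subsequence
    (no_stable hfin hwf D hI hok)
  choose n hn using hne
  have hVm : Monotone D.mgV := monotone_nat_of_le_succ fun i => Set.subset_union_left
  have hEm : Monotone D.mgE := monotone_nat_of_le_succ fun i => Set.subset_union_left
  set v : ℕ → MNode := fun j => (n j, posOfVal (D.inst (φ j + 1)) (n j)) with hv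
  set e : ℕ → MEdge := fun j => ⟨v j, D.cns (φ (j+1)),
    instBodyPos (D.cns (φ (j+1))) (D.asg (φ (j+1))) (n j), v (j+1)⟩ with he
  have hvnew : ∀ j, v j ∈ D.mgNew (φ j) := fun j => ⟨n j, hn j, rfl⟩
  have heE : ∀ j, e j ∈ D.mgE (φ (j+1) + 1) := by
    intro j
    right
    refine ⟨?_, hvnew (j+1), rfl, rfl⟩
    exact hVm (show φ j + 1 ≤ φ (j+1) from hφ (Nat.lt_succ_self j)) (Or.inr (hvnew j))
  -- distinctness
  have hlt : ∀ i j, i < j → n i ≠ n j := by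
    intro i j hij heq
    have h1 := hn i
    have h2 := hn j
    refine hfresh (φ j + 1) (φ j) (Nat.lt_succ_self _) (n j) h2.1 h2.2.1 h2.2.2
      (φ i + 1) (hφ hij) ?_
    rw [← heq]
    exact h1.2.1
  have hinj : Function.Injective e := by
    intro i j hij
    have h1 : n i = n j := congrArg (fun e : MEdge => e.src.1) hij
    rcases lt_trichotomy i j with h | h | h
    · exact absurd h1 (hlt i j h)
    · exact h
    · exact absurd h1.symm (hlt j i h)
  -- finitely many signatures
  set P : Set Pos :=
    {π : Pos | ∃ A ∈ {A | ∃ α ∈ Sg, A ∈ α.hAtoms}, A.rel = π.1 ∧ π.2 < A.args.length} with hP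
  set Q : Set Pos :=
    {π : Pos | ∃ A ∈ {A | ∃ α ∈ Sg, A ∈ α.bodyAtoms}, A.rel = π.1 ∧ π.2 < A.args.length} with hQ
  have hPf : P.Finite := atomPos_finite (heads_finite hfin)
  have hQf : Q.Finite := atomPos_finite (bodies_finite hfin)
  have hTf : (P.powerset ×ˢ (Sg ×ˢ (Q.powerset ×ˢ P.powerset))).Finite :=
    hPf.powerset.prod (hfin.prod (hQf.powerset.prod hPf.powerset))
  have hvP : ∀ j, (v j).2 ⊆ P := fun j =>
    posOfVal_new (hok (φ j)).1 (hwf _ (hok (φ j)).1) (hok (φ j)).2 (hn j)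
  have hsig : ∀ j, (e j).sig ∈ P.powerset ×ˢ (Sg ×ˢ (Q.powerset ×ˢ P.powerset)) := fun j =>
    ⟨hvP j, (hok _).1, instBodyPos_sub (hok _).1 _ _, hvP (j+1)⟩
  have := hTf.to_subtype
  obtain ⟨y, hy⟩ := Finite.exists_infinite_fiber
    (fun j => (⟨(e j).sig, hsig j⟩ : ↥(P.powerset ×ˢ (Sg ×ˢ (Q.powerset ×ˢ P.powerset)))))
  have hy' := Set.infinite_coe_iff.1 hy
  obtain ⟨ψ, hψ, hψy⟩ := Nat.exists_strictMono_subsequence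
    (P := fun j => (e j).sig = y.1) (fun N => by
      obtain ⟨m, hm, hm'⟩ := hy'.exists_gt N
      exact ⟨m, hm', congrArg Subtype.val hm⟩)
  refine ⟨φ (ψ k) + 1, (List.range (ψ k)).map e, ((List.range k).map ψ).map e,
    ⟨?_, ?_⟩, (sublist_range hψ k).map e, by simp, ?_, ?_⟩
  · intro a ha
    simp only [List.mem_map, List.mem_range] at ha
    obtain ⟨j, hj, rfl⟩ := ha
    exact hEm (Nat.succ_le_succ (hφ.monotone hj)) (heE j)
  · change List.IsChain _ _
    rw [List.isChain_map]
    rw [List.isChain_iff_getElem]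
    intro i hi
    simp [he]
  · exact (List.nodup_range.map hψ.injective).map hinj
  · change List.IsChain _ _
    rw [List.isChain_map, List.isChain_map, List.isChain_iff_getElem]
    intro i hi
    simp [hψy]

end StopChase
end
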